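/- Let G=(X,w,κ,μ) be a connected graph and 1≤p<∞, with condition (C_p) assumed if p>1, and suppose G satisfies condition (IP) or condition (B). If f satisfies (F1), then for every λ>0 and every g∈ℓ^p(X,μ) there exists a unique u∈dom_p(𝒜) solving u+λ𝒜u=g, and ‖u‖_p ≤ 2^{(p−1)/p}‖g‖_p. If instead f satisfies (F2) with constant L>0, the same holds for every 0<λ<1/L with the estimate ‖u‖_p ≤ 2^{(p−1)/p}(1−λL)^{−1}‖g‖_p. Moreover, if g≥0 (resp. g≤0) then u≥0 (resp. u≤0). -/

import Mathlib

open Filter Topology MeasureTheory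

/-- A weighted graph `G = (X, w, κ, μ)`. -/
structure WGraph (X : Type*) where
  w : X → X → ℝ
  kap : X → ℝ
  mu : X → ℝ
  w_nonneg : ∀ x y, 0 ≤ w x y
  w_symm : ∀ x y, w x y = w y x
  w_loopless : ∀ x, w x x = 0
  w_summable : ∀ x, Summable (fun y => w x y)
  kap_nonneg : ∀ x, 0 ≤ kap x
  mu_pos : ∀ x, 0 < mu x

namespace WGraph

variable {X : Type*}

/-- Adjacency: `x ∼ y` iff `w x y > 0`. -/
def Adj (G : WGraph X) (x y : X) : Prop := 0 < G.w x y

/-- `G` is connected: any two nodes are joined by a finite walk. -/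
def Connected (G : WGraph X) : Prop := ∀ x y : X, Relation.ReflTransGen G.Adj x y

/-- An infinite path: injective sequence of consecutively adjacent nodes. -/
def InfinitePath (G : WGraph X) (γ : ℕ → X) : Prop :=
  Function.Injective γ ∧ ∀ n, G.Adj (γ n) (γ (n + 1))

/-- Condition (IP): every infinite path has infinite total measure. -/
def CondIP (G : WGraph X) : Prop :=
  ∀ γ : ℕ → X, G.InfinitePath γ → ¬ Summable (fun n => G.mu (γ n))

/-- Condition (B): bounded edge degree. -/
def CondB (G : WGraph X) : Prop :=
  ∃ C : ℝ, ∀ x, (∑' y, G.w x y) / G.mu x ≤ C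

/-- Condition (C_p). -/
def CondCp (G : WGraph X) (p : ℝ) : Prop :=
  ∀ x, Summable (fun y => G.w x y ^ p / G.mu y ^ (p - 1))

/-- Membership in `ℓ^p(X,μ)` for `1 ≤ p < ∞`. -/
def memLp (G : WGraph X) (p : ℝ) (u : X → ℝ) : Prop :=
  Summable (fun x => |u x| ^ p * G.mu x)

/-- The `ℓ^p(X,μ)`-norm. -/
noncomputable def lpNorm (G : WGraph X) (p : ℝ) (u : X → ℝ) : ℝ :=
  (∑' x, |u x| ^ p * G.mu x) ^ (1 / p)

/-- Membership in the formal domain of the graph Laplacian. -/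
def inDomLap (G : WGraph X) (u : X → ℝ) : Prop :=
  ∀ x, Summable (fun y => G.w x y * |u y|)

/-- The formal graph Laplacian. -/
noncomputable def lap (G : WGraph X) (u : X → ℝ) (x : X) : ℝ :=
  (1 / G.mu x) * ∑' y, G.w x y * (u x - u y) + (G.kap x / G.mu x) * u x

/-- The nonlinear operator `𝒜 u = -f ∘ u + Δ u`. -/
noncomputable def Aop (G : WGraph X) (f : ℝ → ℝ) (u : X → ℝ) (x : X) : ℝ :=
  -f (u x) + G.lap u x

/-- `dom_p(𝒜)`. -/
def inDomA (G : WGraph X) (f : ℝ → ℝ) (p : ℝ) (u : X → ℝ) : Prop :=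
  G.memLp p u ∧ G.inDomLap u ∧ G.memLp p (G.Aop f u)

end WGraph

/-- Condition (F1): `f` continuous, monotone decreasing, `f 0 = 0`. -/
def CondF1 (f : ℝ → ℝ) : Prop := Continuous f ∧ Antitone f ∧ f 0 = 0

/-- Condition (F2): `f` uniformly Lipschitz with constant `L > 0`, `f 0 = 0`. -/
def CondF2 (f : ℝ → ℝ) (L : ℝ) : Prop :=
  0 < L ∧ (∀ s t : ℝ, |f t - f s| ≤ L * |t - s|) ∧ f 0 = 0


open scoped ENNReal in
theorem aux_jensen {ι : Type*} {p : ℝ} (hp : 1 ≤ p) (a z : ι → ℝ≥0∞) (V : ℝ≥0∞)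
    (hm0 : ∑' i, a i ≠ 0) (hmt : ∑' i, a i ≠ ∞)
    (h : (∑' i, a i) * V ≤ ∑' i, a i * z i) :
    (∑' i, a i) * V ^ p ≤ ∑' i, a i * z i ^ p := by
  have hp0 : 0 < p := by linarith
  set m := ∑' i, a i with hm
  set S := ∑' i, a i * z i ^ p with hS
  have h1 : ∑' i, a i * z i ≤ m ^ (1 - p⁻¹) * S ^ p⁻¹ := by
    rw [ENNReal.tsum_eq_iSup_sum]
    refine iSup_le fun s => (ENNReal.inner_le_weight_mul_Lp_of_nonneg s hp a z).trans ?_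
    have : 0 ≤ 1 - p⁻¹ := by
      have := inv_le_one_of_one_le₀ hp
      linarith
    gcongr
    · exact ENNReal.sum_le_tsum s
    · exact ENNReal.sum_le_tsum s
  have h2 : m * V ≤ m ^ (1 - p⁻¹) * S ^ p⁻¹ := h.trans h1
  have h3 := ENNReal.rpow_le_rpow h2 hp0.le
  rw [ENNReal.mul_rpow_of_nonneg _ _ hp0.le, ENNReal.mul_rpow_of_nonneg _ _ hp0.le,
    ← ENNReal.rpow_mul, ← ENNReal.rpow_mul, inv_mul_cancel₀ hp0.ne', ENNReal.rpow_one] at h3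
  have e1 : (1 - p⁻¹) * p = p - 1 := by field_simp
  rw [e1] at h3
  have e2 : m ^ p = m ^ (p - 1) * m := by
    conv_lhs => rw [show p = (p - 1) + 1 by ring]
    rw [ENNReal.rpow_add _ _ hm0 hmt, ENNReal.rpow_one]
  rw [e2, mul_assoc] at h3
  have i0 : m ^ (p - 1) ≠ 0 := by
    intro hh
    rcases ENNReal.rpow_eq_zero_iff.1 hh with hh | hh
    · exact hm0 hh.1
    · exact hmt hh.1
  have it : m ^ (p - 1) ≠ ∞ := by
    intro hh
    rcases ENNReal.rpow_eq_top_iff.1 hh with hh | hh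
    · exact hm0 hh.1
    · exact hmt hh.1
  exact (ENNReal.mul_le_mul_iff_right i0 it).1 h3

open scoped ENNReal in
theorem aux_key {X : Type*} {p : ℝ} (hp : 1 ≤ p) (N : X → ℝ≥0∞) (b : X → X → ℝ≥0∞)
    (hN0 : ∀ x, N x ≠ 0) (hNt : ∀ x, N x ≠ ∞) (hb : ∀ x y, b x y = b y x)
    (hbt : ∀ x, ∑' y, b x y ≠ ∞) (γ v V : X → ℝ≥0∞)
    (h : ∀ x, (N x + ∑' y, b x y) * V x ≤ N x * γ x + ∑' y, b x y * v y) :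
    ∑' x, N x * V x ^ p + ∑' x, (∑' y, b x y) * V x ^ p ≤
      ∑' x, N x * γ x ^ p + ∑' x, (∑' y, b x y) * v x ^ p := by
  have key : ∀ x, (N x + ∑' y, b x y) * V x ^ p ≤ N x * γ x ^ p + ∑' y, b x y * v y ^ p := by
    intro x
    have := aux_jensen (ι := Option X) hp (fun o => o.elim (N x) (b x))
      (fun o => o.elim (γ x) v) (V x)
    have e : ∀ F : Option X → ℝ≥0∞, ∑' o, F o = F none + ∑' y, F (some y) := by
      intro F
      rw [← (Equiv.optionEquivSumPUnit.{0} X).symm.tsum_eq F,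
        ENNReal.summable.tsum_sum (f := fun c => F ((Equiv.optionEquivSumPUnit.{0} X).symm c)) ENNReal.summable]
      simp [add_comm]
    simp only [e, Option.elim] at this
    exact this (by simp [hN0 x]) (by simp [hNt x, hbt x]) (h x)
  calc ∑' x, N x * V x ^ p + ∑' x, (∑' y, b x y) * V x ^ p
      = ∑' x, (N x + ∑' y, b x y) * V x ^ p := by
        rw [← ENNReal.tsum_add]; simp only [add_mul]
    _ ≤ ∑' x, (N x * γ x ^ p + ∑' y, b x y * v y ^ p) := ENNReal.tsum_le_tsum key
    _ = ∑' x, N x * γ x ^ p + ∑' x, ∑' y, b x y * v y ^ p := ENNReal.tsum_add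
    _ = _ := by
        rw [ENNReal.tsum_comm]
        congr 1
        refine tsum_congr fun y => ?_
        rw [ENNReal.tsum_mul_right]
        simp only [hb y]

open scoped ENNReal in
theorem aux_super {X : Type*} {p : ℝ} (hp : 1 ≤ p) (N : X → ℝ≥0∞) (b : X → X → ℝ≥0∞)
    (hN0 : ∀ x, N x ≠ 0) (hNt : ∀ x, N x ≠ ∞) (hb : ∀ x y, b x y = b y x)
    (hbt : ∀ x, ∑' y, b x y ≠ ∞) (γ : X → ℝ≥0∞) (hγ : ∑' x, N x * γ x ^ p ≠ ∞) :
    ∃ v : X → ℝ≥0∞, (∀ x, N x * γ x + ∑' y, b x y * v y ≤ (N x + ∑' y, b x y) * v x) ∧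
      ∑' x, N x * v x ^ p ≤ ∑' x, N x * γ x ^ p := by
  have hp0 : 0 < p := by linarith
  let S : (X → ℝ≥0∞) → (X → ℝ≥0∞) := fun v x =>
    (N x * γ x + ∑' y, b x y * v y) / (N x + ∑' y, b x y)
  have hSmono : Monotone S := by
    intro v v' hv x
    have := fun y => hv y
    simp only [S]
    gcongr
    exact this _
  let u : ℕ → X → ℝ≥0∞ := fun n => S^[n] 0
  have hu0 : u 0 = 0 := rfl
  have hus : ∀ n, u (n + 1) = S (u n) := fun n => Function.iterate_succ_apply' S n 0
  have hmono : Monotone u := by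
    refine monotone_nat_of_le_succ fun n => ?_
    induction n with
    | zero => rw [hu0]; exact fun x => zero_le
    | succ k ih => exact (hus k).le.trans ((hSmono ih).trans (hus (k+1)).ge)
  have heq : ∀ n x, (N x + ∑' y, b x y) * u (n+1) x = N x * γ x + ∑' y, b x y * u n y := by
    intro n x
    rw [hus]
    exact ENNReal.mul_div_cancel (by simp [hN0 x]) (by simp [hNt x, hbt x])
  have hkey := fun n => aux_key hp N b hN0 hNt hb hbt γ (u n) (u (n+1)) (fun x => (heq n x).le)
  have hfin : ∀ n, ∑' x, (∑' y, b x y) * u n x ^ p ≠ ∞ := by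
    intro n
    induction n with
    | zero => simp [hu0, hp0]
    | succ k ih =>
      exact ne_top_of_le_ne_top (ENNReal.add_ne_top.2 ⟨hγ, ih⟩)
        (le_trans le_add_self (hkey k))
  have hbd : ∀ n, ∑' x, N x * u n x ^ p ≤ ∑' x, N x * γ x ^ p := by
    intro n
    have h1 : ∑' x, N x * u n x ^ p ≤ ∑' x, N x * u (n+1) x ^ p := by
      refine ENNReal.tsum_le_tsum fun x => ?_
      gcongr
      exact hmono (Nat.le_succ n) x
    have h2 : ∑' x, (∑' y, b x y) * u n x ^ p ≤ ∑' x, (∑' y, b x y) * u (n+1) x ^ p := by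
      refine ENNReal.tsum_le_tsum fun x => ?_
      gcongr
      exact hmono (Nat.le_succ n) x
    exact ENNReal.le_of_add_le_add_right (hfin n) ((add_le_add h1 h2).trans (hkey n))
  have hsup : ∀ (a : X → ℝ≥0∞) (z : ℕ → X → ℝ≥0∞) (B : ℝ≥0∞), Monotone z →
      (∀ n, ∑' x, a x * z n x ≤ B) → ∑' x, a x * (⨆ n, z n x) ≤ B := by
    intro a z B hz hB
    rw [ENNReal.tsum_eq_iSup_sum]
    refine iSup_le fun s => ?_
    simp only [ENNReal.mul_iSup]
    rw [ENNReal.finsetSum_iSup_of_monotone]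
    · exact iSup_le fun n => (ENNReal.sum_le_tsum s).trans (hB n)
    · intro x i j hij
      dsimp only
      gcongr
      exact hz hij x
  refine ⟨fun x => ⨆ n, u n x, fun x => ?_, ?_⟩
  · have hne : N x * γ x ≠ ∞ := by
      have h1 := ENNReal.ne_top_of_tsum_ne_top hγ x
      refine ENNReal.mul_ne_top (hNt x) fun h => h1 ?_
      rw [h, ENNReal.top_rpow_of_pos hp0, ENNReal.mul_top (hN0 x)]
    have hle : ∀ n, N x * γ x + ∑' y, b x y * u n y ≤ (N x + ∑' y, b x y) * ⨆ n, u n x := by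
      intro n
      rw [← heq]
      gcongr
      exact le_iSup (fun n => u n x) (n+1)
    have h0 : N x * γ x ≤ (N x + ∑' y, b x y) * ⨆ n, u n x := le_self_add.trans (hle 0)
    have := hsup (b x) u _ hmono (fun n => ENNReal.le_sub_of_add_le_left hne (hle n))
    calc _ ≤ N x * γ x + _ := add_le_add le_rfl this
      _ = _ := add_tsub_cancel_of_le h0
  · have e : ∀ x, (⨆ n, u n x) ^ p = ⨆ n, u n x ^ p := fun x =>
      (ENNReal.orderIsoRpow p hp0).map_iSup (fun n => u n x)
    simp only [e]
    refine hsup N (fun n x => u n x ^ p) _ ?_ hbd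
    intro i j hij x
    exact ENNReal.rpow_le_rpow (hmono hij x) hp0.le

namespace WGraph

variable {X : Type*}

theorem aux_rpow_sub {p a b : ℝ} (hp : 1 ≤ p) : |a - b| ^ p ≤ 2 ^ p * (|a| ^ p + |b| ^ p) := by
  have hp0 : 0 ≤ p := by linarith
  have h1 : 0 ≤ |a| ^ p := by positivity
  have h2 : 0 ≤ |b| ^ p := by positivity
  have h0 : |a - b| ≤ |a| + |b| := abs_sub a b
  rcases le_total |a| |b| with h | h
  · calc |a - b| ^ p ≤ (2 * |b|) ^ p := by
          apply Real.rpow_le_rpow (abs_nonneg _) (by linarith) hp0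
      _ = 2 ^ p * |b| ^ p := Real.mul_rpow (by norm_num) (abs_nonneg _)
      _ ≤ _ := by gcongr; linarith
  · calc |a - b| ^ p ≤ (2 * |a|) ^ p := by
          apply Real.rpow_le_rpow (abs_nonneg _) (by linarith) hp0
      _ = 2 ^ p * |a| ^ p := Real.mul_rpow (by norm_num) (abs_nonneg _)
      _ ≤ _ := by gcongr; linarith

theorem memLp_sub (G : WGraph X) {p : ℝ} (hp : 1 ≤ p) {u v : X → ℝ} (hu : G.memLp p u)
    (hv : G.memLp p v) : G.memLp p (fun x => u x - v x) := by
  have h := (Summable.add hu hv).mul_left ((2:ℝ) ^ p)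
  refine Summable.of_nonneg_of_le (fun x => ?_) (fun x => ?_) h
  · have := (G.mu_pos x).le
    positivity
  · have := mul_le_mul_of_nonneg_right (aux_rpow_sub (a := u x) (b := v x) hp) (G.mu_pos x).le
    linarith

theorem memLp_of_le (G : WGraph X) {p : ℝ} (hp : 1 ≤ p) {u v : X → ℝ} (hu : G.memLp p u)
    (hv : ∀ x, |v x| ≤ |u x|) : G.memLp p v := by
  refine Summable.of_nonneg_of_le (fun x => ?_) (fun x => ?_) hu
  · have := (G.mu_pos x).le
    positivity
  · have := (G.mu_pos x).le
    have := hv x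
    gcongr

theorem summable_w (G : WGraph X) {u : X → ℝ} (hu : G.inDomLap u) (x : X) :
    Summable (fun y => G.w x y * u y) := by
  refine Summable.of_norm ?_
  refine (hu x).congr fun y => ?_
  rw [Real.norm_eq_abs, abs_mul, abs_of_nonneg (G.w_nonneg x y)]

theorem lap_eq (G : WGraph X) {u : X → ℝ} (hu : G.inDomLap u) (x : X) :
    G.mu x * G.lap u x =
      (∑' y, G.w x y) * u x - ∑' y, G.w x y * u y + G.kap x * u x := by
  have hm := (G.mu_pos x).ne'
  have : ∑' y, G.w x y * (u x - u y) = (∑' y, G.w x y) * u x - ∑' y, G.w x y * u y := by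
    simp only [mul_sub]
    rw [((G.w_summable x).mul_right (u x)).tsum_sub (G.summable_w hu x), tsum_mul_right]
  rw [lap, this]
  field_simp

open scoped ENNReal in
theorem aux_conv (G : WGraph X) {p c : ℝ} (hp : 1 ≤ p) (hc : 0 < c) {z : X → ℝ}
    (hz : ∀ x, 0 ≤ z x) (hm : G.memLp p z) :
    ∑' x, ENNReal.ofReal (c * G.mu x) * ENNReal.ofReal (z x) ^ p =
      ENNReal.ofReal (c * ∑' x, |z x| ^ p * G.mu x) := by
  rw [← tsum_mul_left, ENNReal.ofReal_tsum_of_nonneg]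
  · refine tsum_congr fun x => ?_
    have := G.mu_pos x
    rw [ENNReal.ofReal_rpow_of_nonneg (hz x) (by linarith), ← ENNReal.ofReal_mul (by positivity),
      abs_of_nonneg (hz x)]
    congr 1; ring
  · intro x
    have := (G.mu_pos x).le
    positivity
  · exact hm.mul_left c

theorem aux_D (G : WGraph X) {lam : ℝ} (hl : 0 < lam) (x : X) :
    ∑' y, ENNReal.ofReal (lam * G.w x y) = ENNReal.ofReal (lam * ∑' y, G.w x y) := by
  rw [← tsum_mul_left, ENNReal.ofReal_tsum_of_nonneg]
  · intro y
    have := G.w_nonneg x y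
    positivity
  · exact (G.w_summable x).mul_left lam

theorem aux_bv (G : WGraph X) {lam : ℝ} (hl : 0 < lam) {z : X → ℝ} (hz : ∀ x, 0 ≤ z x) (x : X)
    (hs : Summable (fun y => G.w x y * z y)) :
    ∑' y, ENNReal.ofReal (lam * G.w x y) * ENNReal.ofReal (z y) =
      ENNReal.ofReal (lam * ∑' y, G.w x y * z y) := by
  rw [← tsum_mul_left, ENNReal.ofReal_tsum_of_nonneg]
  · refine tsum_congr fun y => ?_
    have := G.w_nonneg x y
    rw [← ENNReal.ofReal_mul (by positivity), mul_assoc]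
  · intro y
    have := G.w_nonneg x y
    have := hz y
    positivity
  · exact hs.mul_left lam

theorem aux_ip (G : WGraph X) {p : ℝ} (hp : 1 ≤ p) (hIP : G.CondIP) (d : X → ℝ)
    (hd : G.memLp p d) (hstep : ∀ x, 0 < d x → ∃ y, G.Adj x y ∧ d x < d y) (x : X) : d x ≤ 0 := by
  by_contra hx
  push Not at hx
  choose! nx hadj hlt using hstep
  let γ : ℕ → X := fun n => nx^[n] x
  have hγs : ∀ n, γ (n+1) = nx (γ n) := fun n => Function.iterate_succ_apply' nx n x
  have hpos : ∀ n, 0 < d (γ n) := by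
    intro n
    induction n with
    | zero => exact hx
    | succ k ih => rw [hγs]; exact ih.trans (hlt _ ih)
  have hsm : StrictMono (fun n => d (γ n)) := by
    refine strictMono_nat_of_lt_succ fun n => ?_
    rw [hγs]; exact hlt _ (hpos n)
  have hinj : Function.Injective γ := fun a b hab => hsm.injective (congrArg d hab)
  refine hIP γ ⟨hinj, fun n => ?_⟩ ?_
  · rw [hγs]; exact hadj _ (hpos n)
  · have h1 : Summable (fun n => |d (γ n)| ^ p * G.mu (γ n)) := hd.comp_injective hinj
    have h2 := h1.mul_left ((d x ^ p)⁻¹)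
    have hxp : 0 < d x ^ p := Real.rpow_pos_of_pos hx p
    refine Summable.of_nonneg_of_le (fun n => (G.mu_pos _).le) (fun n => ?_) h2
    have h3 : d x ^ p ≤ |d (γ n)| ^ p := by
      refine Real.rpow_le_rpow hx.le ?_ (by linarith)
      exact (hsm.monotone (Nat.zero_le n)).trans (le_abs_self _)
    have := G.mu_pos (γ n)
    rw [← mul_assoc]
    refine le_mul_of_one_le_left this.le ?_
    rw [inv_mul_eq_div, one_le_div hxp]
    exact h3

theorem aux_b (G : WGraph X) {p c lam : ℝ} (hp : 1 ≤ p) (hc : 0 < c) (hl : 0 < lam)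
    (hB : G.CondB) (d : X → ℝ)
    (hd : G.memLp p d) (hdd : G.inDomLap d)
    (hk : ∀ x, 0 < d x →
      (c * G.mu x + lam * ∑' y, G.w x y) * d x ≤ lam * ∑' y, G.w x y * d y) (x : X) :
    d x ≤ 0 := by
  have hp0 : 0 < p := by linarith
  obtain ⟨C, hC⟩ := hB
  let e : X → ℝ := fun x => max (d x) 0
  have he : ∀ x, 0 ≤ e x := fun x => le_max_right _ _
  have hed : ∀ x, |e x| ≤ |d x| := fun x => by
    rw [abs_of_nonneg (he x)]; exact max_le (le_abs_self _) (abs_nonneg _)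
  have hem : G.memLp p e := G.memLp_of_le hp hd hed
  have hes : G.inDomLap e := fun x => by
    refine Summable.of_nonneg_of_le (fun y => ?_) (fun y => ?_) (hdd x)
    · exact mul_nonneg (G.w_nonneg x y) (abs_nonneg _)
    · exact mul_le_mul_of_nonneg_left (hed y) (G.w_nonneg x y)
  have hdeg : ∀ x, 0 ≤ ∑' y, G.w x y := fun x => tsum_nonneg (G.w_nonneg x)
  have key := aux_key hp (fun x => ENNReal.ofReal (c * G.mu x))
    (fun x y => ENNReal.ofReal (lam * G.w x y))
    (fun x => by simpa using mul_pos hc (G.mu_pos x)) (fun x => ENNReal.ofReal_ne_top)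
    (fun x y => by rw [G.w_symm]) (fun x => by rw [G.aux_D hl]; exact ENNReal.ofReal_ne_top)
    (fun _ => 0) (fun x => ENNReal.ofReal (e x)) (fun x => ENNReal.ofReal (e x)) (by
      intro x
      rw [G.aux_D hl, G.aux_bv hl he x (G.summable_w hes x)]
      have hmu := G.mu_pos x
      have hdx := hdeg x
      rw [← ENNReal.ofReal_add (by positivity) (by positivity),
        ← ENNReal.ofReal_mul (by positivity), mul_zero, zero_add]
      refine ENNReal.ofReal_le_ofReal ?_
      have hnn : 0 ≤ ∑' y, G.w x y * e y :=
        tsum_nonneg fun y => mul_nonneg (G.w_nonneg x y) (he y)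
      rcases le_or_gt (d x) 0 with h0 | h0
      · have : e x = 0 := max_eq_right h0
        rw [this, mul_zero]; positivity
      · have : e x = d x := max_eq_left h0.le
        rw [this]
        refine (hk x h0).trans ?_
        refine mul_le_mul_of_nonneg_left ?_ hl.le
        refine (G.summable_w hdd x).tsum_le_tsum (fun y => ?_) (G.summable_w hes x)
        exact mul_le_mul_of_nonneg_left (le_max_left _ _) (G.w_nonneg x y))
  have hfin : ∑' x, (∑' y, ENNReal.ofReal (lam * G.w x y)) * ENNReal.ofReal (e x) ^ p ≠ ⊤ := by
    have h1 : ∑' x, ENNReal.ofReal (lam * |C| / c) *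
        (ENNReal.ofReal (c * G.mu x) * ENNReal.ofReal (e x) ^ p) ≠ ⊤ := by
      rw [ENNReal.tsum_mul_left, G.aux_conv hp hc he hem]
      exact ENNReal.mul_ne_top ENNReal.ofReal_ne_top ENNReal.ofReal_ne_top
    refine ne_top_of_le_ne_top h1 (ENNReal.tsum_le_tsum fun x => ?_)
    rw [← mul_assoc, G.aux_D hl, ← ENNReal.ofReal_mul (by positivity)]
    refine mul_le_mul_left (ENNReal.ofReal_le_ofReal ?_) _
    have hmu := G.mu_pos x
    have h2 := hC x
    rw [div_le_iff₀ hmu] at h2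
    have h3 : C * G.mu x ≤ |C| * G.mu x := mul_le_mul_of_nonneg_right (le_abs_self C) hmu.le
    have h4 : lam * |C| / c * (c * G.mu x) = lam * (|C| * G.mu x) := by field_simp
    rw [h4]
    exact mul_le_mul_of_nonneg_left (h2.trans h3) hl.le
  simp only [ENNReal.zero_rpow_of_pos hp0, mul_zero, tsum_zero, zero_add] at key
  have hz : ∑' x, ENNReal.ofReal (c * G.mu x) * ENNReal.ofReal (e x) ^ p ≤ 0 := by
    refine ENNReal.le_of_add_le_add_right hfin ?_
    rw [zero_add]; exact key
  have h5 := ENNReal.tsum_eq_zero.1 (le_antisymm hz zero_le) x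
  have h6 : ENNReal.ofReal (c * G.mu x) ≠ 0 := by simpa using mul_pos hc (G.mu_pos x)
  have h7 := (mul_eq_zero.1 h5).resolve_left h6
  have h8 : ENNReal.ofReal (e x) = 0 := by
    rcases ENNReal.rpow_eq_zero_iff.1 h7 with h | h
    · exact h.1
    · linarith [h.2]
  exact (le_max_left _ _).trans (ENNReal.ofReal_eq_zero.1 h8)

theorem aux_cmp (G : WGraph X) {p c lam : ℝ} (hp : 1 ≤ p) (hc : 0 < c) (hl : 0 < lam)
    (hcond : G.CondIP ∨ G.CondB) (h : ℝ → ℝ)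
    (hh : ∀ s t, t ≤ s → c * (s - t) ≤ h s - h t) {u v : X → ℝ}
    (hu : G.memLp p u) (hv : G.memLp p v) (hud : G.inDomLap u) (hvd : G.inDomLap v)
    (hle : ∀ x, h (u x) + lam * G.lap u x ≤ h (v x) + lam * G.lap v x) (x : X) : u x ≤ v x := by
  let d : X → ℝ := fun x => u x - v x
  have hd : G.memLp p d := G.memLp_sub hp hu hv
  have hdd : G.inDomLap d := fun x => by
    refine Summable.of_nonneg_of_le (fun y => ?_) (fun y => ?_) ((hud x).add (hvd x))
    · exact mul_nonneg (G.w_nonneg x y) (abs_nonneg _)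
    · rw [← mul_add]
      exact mul_le_mul_of_nonneg_left (abs_sub _ _) (G.w_nonneg x y)
  have hk : ∀ x, 0 < d x →
      (c * G.mu x + lam * ∑' y, G.w x y) * d x ≤ lam * ∑' y, G.w x y * d y := by
    intro x hx
    have h1 := hh (u x) (v x) (by have : 0 < u x - v x := hx; linarith)
    have h2 := mul_le_mul_of_nonneg_left (hle x) (G.mu_pos x).le
    have h3 := mul_le_mul_of_nonneg_left h1 (G.mu_pos x).le
    have e1 := G.lap_eq hud x
    have e2 := G.lap_eq hvd x
    have e3 : ∑' y, G.w x y * d y = ∑' y, G.w x y * u y - ∑' y, G.w x y * v y := by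
      rw [← (G.summable_w hud x).tsum_sub (G.summable_w hvd x)]
      simp only [d, mul_sub]
    have h4 : 0 ≤ lam * (G.kap x * d x) := mul_nonneg hl.le (mul_nonneg (G.kap_nonneg x) hx.le)
    rw [e3]
    have e1' : G.mu x * (lam * G.lap u x) = lam * ((∑' y, G.w x y) * u x - ∑' y, G.w x y * u y + G.kap x * u x) := by
      rw [← e1]; ring
    have e2' : G.mu x * (lam * G.lap v x) = lam * ((∑' y, G.w x y) * v x - ∑' y, G.w x y * v y + G.kap x * v x) := by
      rw [← e2]; ring
    rw [mul_add, mul_add, e1', e2'] at h2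
    simp only [d] at h4 ⊢
    linarith
  have : d x ≤ 0 := by
    rcases hcond with hIP | hB
    · refine G.aux_ip hp hIP d hd (fun x hx => ?_) x
      by_contra hcon
      push Not at hcon
      have h1 : ∑' y, G.w x y * d y ≤ ∑' y, G.w x y * d x := by
        refine (G.summable_w hdd x).tsum_le_tsum (fun y => ?_) ((G.w_summable x).mul_right _)
        rcases (G.w_nonneg x y).eq_or_lt with h0 | h0
        · rw [← h0]; simp
        · exact mul_le_mul_of_nonneg_left (hcon y h0) h0.le
      rw [tsum_mul_right] at h1
      have h2 := hk x hx
      have h3 := mul_le_mul_of_nonneg_left h1 hl.le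
      have h4 : 0 < c * G.mu x * d x := mul_pos (mul_pos hc (G.mu_pos x)) hx
      linarith
    · exact G.aux_b hp hc hl hB d hd hdd hk x
  have h' : u x - v x ≤ 0 := this
  linarith

open scoped ENNReal in
theorem aux_super_real (G : WGraph X) {p c lam : ℝ} (hp : 1 ≤ p) (hc : 0 < c) (hl : 0 < lam)
    {g : X → ℝ} (hg : G.memLp p g) :
    ∃ v : X → ℝ, (∀ x, 0 ≤ v x) ∧ G.memLp p v ∧ G.inDomLap v ∧
      (∀ x, G.mu x * |g x| + lam * ∑' y, G.w x y * v y ≤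
        (c * G.mu x + lam * ∑' y, G.w x y) * v x) ∧
      G.lpNorm p v ≤ c⁻¹ * G.lpNorm p g := by
  have hp0 : 0 < p := by linarith
  let z : X → ℝ := fun x => c⁻¹ * |g x|
  have hz : ∀ x, 0 ≤ z x := fun x => by positivity
  have hzp : ∀ x, |z x| ^ p * G.mu x = (c⁻¹) ^ p * (|g x| ^ p * G.mu x) := fun x => by
    rw [abs_of_nonneg (hz x), Real.mul_rpow (by positivity) (abs_nonneg _), mul_assoc]
  have hzm : G.memLp p z := by
    refine (Summable.mul_left ((c⁻¹) ^ p) hg).congr fun x => (hzp x).symm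
  have hN0 : ∀ x, ENNReal.ofReal (c * G.mu x) ≠ 0 := fun x => by
    simpa using mul_pos hc (G.mu_pos x)
  obtain ⟨v, hv1, hv2⟩ := aux_super hp (fun x => ENNReal.ofReal (c * G.mu x))
    (fun x y => ENNReal.ofReal (lam * G.w x y)) hN0
    (fun x => ENNReal.ofReal_ne_top)
    (fun x y => by rw [G.w_symm]) (fun x => by rw [G.aux_D hl]; exact ENNReal.ofReal_ne_top)
    (fun x => ENNReal.ofReal (z x))
    (by rw [G.aux_conv hp hc hz hzm]; exact ENNReal.ofReal_ne_top)
  rw [G.aux_conv hp hc hz hzm] at hv2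
  have hsum : ∑' x, ENNReal.ofReal (c * G.mu x) * v x ^ p ≠ ∞ :=
    ne_top_of_le_ne_top ENNReal.ofReal_ne_top hv2
  have hvt : ∀ x, v x ≠ ∞ := fun x h => by
    refine ENNReal.ne_top_of_tsum_ne_top hsum x ?_
    rw [h, ENNReal.top_rpow_of_pos hp0, ENNReal.mul_top (hN0 x)]
  obtain ⟨r, hr⟩ : ∃ r : X → ℝ, ∀ x, r x = (v x).toReal := ⟨_, fun _ => rfl⟩
  have hr0 : ∀ x, 0 ≤ r x := fun x => by rw [hr]; exact ENNReal.toReal_nonneg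
  have hvr : ∀ x, v x = ENNReal.ofReal (r x) := fun x => by
    rw [hr, ENNReal.ofReal_toReal (hvt x)]
  simp only [hvr] at hv1 hv2 hsum
  have hrm : G.memLp p r := by
    have h1 := (ENNReal.summable_toReal hsum).mul_left c⁻¹
    refine h1.congr fun x => ?_
    have := G.mu_pos x
    rw [ENNReal.ofReal_rpow_of_nonneg (hr0 x) hp0.le, ← ENNReal.ofReal_mul (by positivity),
      ENNReal.toReal_ofReal (mul_nonneg (by positivity) (Real.rpow_nonneg (hr0 x) p)),
      abs_of_nonneg (hr0 x)]
    field_simp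
  rw [G.aux_conv hp hc hr0 hrm] at hv2
  have hdeg : ∀ x, 0 ≤ ∑' y, G.w x y := fun x => tsum_nonneg (G.w_nonneg x)
  have hs : ∀ x, Summable (fun y => G.w x y * r y) := by
    intro x
    have h1 : ∑' y, ENNReal.ofReal (lam * G.w x y) * ENNReal.ofReal (r y) ≠ ∞ := by
      refine ne_top_of_le_ne_top ?_ (le_add_self.trans (hv1 x))
      rw [G.aux_D hl]
      exact ENNReal.mul_ne_top (ENNReal.add_ne_top.2 ⟨ENNReal.ofReal_ne_top, ENNReal.ofReal_ne_top⟩)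
        ENNReal.ofReal_ne_top
    have h2 := (ENNReal.summable_toReal h1).mul_left lam⁻¹
    refine h2.congr fun y => ?_
    have := G.w_nonneg x y
    have := hr0 y
    rw [← ENNReal.ofReal_mul (by positivity), ENNReal.toReal_ofReal (by positivity)]
    field_simp
  refine ⟨r, hr0, hrm, fun x => ?_, fun x => ?_, ?_⟩
  · refine (hs x).congr fun y => ?_
    rw [abs_of_nonneg (hr0 y)]
  · have h1 := hv1 x
    have hmu := G.mu_pos x
    have hdx := hdeg x
    have hrx := hr0 x
    have hzx := hz x
    have hnn : 0 ≤ ∑' y, G.w x y * r y :=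
      tsum_nonneg fun y => mul_nonneg (G.w_nonneg x y) (hr0 y)
    rw [G.aux_D hl, G.aux_bv hl hr0 x (hs x), ← ENNReal.ofReal_mul (by positivity),
      ← ENNReal.ofReal_add (by positivity) (by positivity),
      ← ENNReal.ofReal_add (by positivity) (by positivity),
      ← ENNReal.ofReal_mul (by positivity),
      ENNReal.ofReal_le_ofReal_iff (by positivity)] at h1
    have e : c * G.mu x * z x = G.mu x * |g x| := by simp only [z]; field_simp
    rw [e] at h1
    exact h1
  · have hB : 0 ≤ ∑' x, |z x| ^ p * G.mu x := tsum_nonneg fun x => by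
      have := (G.mu_pos x).le
      positivity
    have hA : 0 ≤ ∑' x, |r x| ^ p * G.mu x := tsum_nonneg fun x => by
      have := (G.mu_pos x).le
      positivity
    have hG0 : 0 ≤ ∑' x, |g x| ^ p * G.mu x := tsum_nonneg fun x => by
      have := (G.mu_pos x).le
      positivity
    rw [ENNReal.ofReal_le_ofReal_iff (by positivity)] at hv2
    have h1 := le_of_mul_le_mul_left hv2 hc
    simp only [hzp] at h1
    rw [tsum_mul_left] at h1
    unfold lpNorm
    refine (Real.rpow_le_rpow hA h1 (by positivity)).trans (le_of_eq ?_)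
    rw [Real.mul_rpow (by positivity) hG0, ← Real.rpow_mul (by positivity),
      mul_one_div_cancel hp0.ne', Real.rpow_one]

theorem aux_inv {a k c : ℝ} (ha : 0 < a) (hk : 0 ≤ k) (hc : 0 < c) {h : ℝ → ℝ}
    (hcont : Continuous h) (hh : ∀ s t, t ≤ s → c * (s - t) ≤ h s - h t) (h0 : h 0 = 0) :
    ∃ Ψ : ℝ → ℝ, Monotone Ψ ∧ (∀ t, a * h (Ψ t) + k * Ψ t = t) ∧
      (∀ s t, t ≤ a * h s + k * s → Ψ t ≤ s) ∧ (∀ s t, a * h s + k * s ≤ t → s ≤ Ψ t) := by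
  have hmono : StrictMono (fun s => a * h s + k * s) := by
    intro t s hts
    have h1 := mul_le_mul_of_nonneg_left (hh s t hts.le) ha.le
    have h2 : 0 < a * (c * (s - t)) := mul_pos ha (mul_pos hc (by linarith))
    have h3 := mul_le_mul_of_nonneg_left hts.le hk
    dsimp only
    linarith
  have hsurj : Function.Surjective (fun s => a * h s + k * s) := by
    refine Continuous.surjective (by fun_prop) ?_ ?_
    · refine tendsto_atTop_mono' _ ?_ (tendsto_id.const_mul_atTop (mul_pos ha hc))
      filter_upwards [eventually_ge_atTop 0] with s hs
      have h1 := mul_le_mul_of_nonneg_left (hh s 0 hs) ha.le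
      have h2 := mul_nonneg hk hs
      rw [h0] at h1
      simp only [id]
      linarith
    · refine tendsto_atBot_mono' _ ?_ (tendsto_id.const_mul_atBot (mul_pos ha hc))
      filter_upwards [eventually_le_atBot 0] with s hs
      have h1 := mul_le_mul_of_nonneg_left (hh 0 s hs) ha.le
      have h2 := mul_nonpos_of_nonneg_of_nonpos hk hs
      rw [h0] at h1
      simp only [id]
      linarith
  choose Ψ hΨ using hsurj
  have hA : ∀ s t, t ≤ a * h s + k * s → Ψ t ≤ s := fun s t hst =>
    hmono.le_iff_le.1 ((hΨ t).le.trans hst)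
  have hB : ∀ s t, a * h s + k * s ≤ t → s ≤ Ψ t := fun s t hst =>
    hmono.le_iff_le.1 (hst.trans (hΨ t).ge)
  exact ⟨Ψ, fun t t' htt => hA _ _ (htt.trans (hΨ t').ge), hΨ, hA, hB⟩

theorem aux_exists (G : WGraph X) {p c lam : ℝ} (hp : 1 ≤ p) (hc : 0 < c) (hl : 0 < lam)
    {h : ℝ → ℝ} (hcont : Continuous h)
    (hh : ∀ s t, t ≤ s → c * (s - t) ≤ h s - h t) (h0 : h 0 = 0)
    {g : X → ℝ} (hg : G.memLp p g) :
    ∃ u : X → ℝ, G.memLp p u ∧ G.inDomLap u ∧ (∀ x, h (u x) + lam * G.lap u x = g x) ∧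
      G.lpNorm p u ≤ c⁻¹ * G.lpNorm p g := by
  obtain ⟨v, hv0, hvm, hvd, hvs, hvn⟩ := G.aux_super_real hp hc hl hg
  have hdeg : ∀ x, 0 ≤ ∑' y, G.w x y := fun x => tsum_nonneg (G.w_nonneg x)
  have hinv := fun x => aux_inv (G.mu_pos x)
    (mul_nonneg hl.le (add_nonneg (hdeg x) (G.kap_nonneg x))) hc hcont hh h0
  choose Ψ hΨm hΨ hΨ1 hΨ2 using hinv
  have hdom : ∀ u : X → ℝ, -v ≤ u → u ≤ v → ∀ x, |u x| ≤ |v x| := fun u h1 h2 x => by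
    rw [abs_of_nonneg (hv0 x)]
    exact abs_le.2 ⟨h1 x, h2 x⟩
  have hdomd : ∀ u : X → ℝ, -v ≤ u → u ≤ v → G.inDomLap u := fun u h1 h2 x => by
    refine Summable.of_nonneg_of_le (fun y => ?_) (fun y => ?_) (hvd x)
    · exact mul_nonneg (G.w_nonneg x y) (abs_nonneg _)
    · exact mul_le_mul_of_nonneg_left (hdom u h1 h2 y) (G.w_nonneg x y)
  let T : (X → ℝ) → (X → ℝ) := fun u x => Ψ x (G.mu x * g x + lam * ∑' y, G.w x y * u y)
  have hWm : ∀ u u' : X → ℝ, G.inDomLap u → G.inDomLap u' → u ≤ u' → ∀ x,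
      ∑' y, G.w x y * u y ≤ ∑' y, G.w x y * u' y := fun u u' hu hu' hle x =>
    (G.summable_w hu x).tsum_le_tsum
      (fun y => mul_le_mul_of_nonneg_left (hle y) (G.w_nonneg x y)) (G.summable_w hu' x)
  have hvv : -v ≤ v := fun x => by
    have := hv0 x
    simp only [Pi.neg_apply]
    linarith
  have hnegd := hdomd (-v) le_rfl hvv
  have hT1 : ∀ u : X → ℝ, -v ≤ u → u ≤ v → T u ≤ v := by
    intro u h1 h2 x
    refine hΨ1 x _ _ ?_
    have e1 := mul_le_mul_of_nonneg_left (hWm u v (hdomd u h1 h2) hvd h2 x) hl.le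
    have e2 := hvs x
    have e3 := mul_le_mul_of_nonneg_left (le_abs_self (g x)) (G.mu_pos x).le
    have e4 := mul_le_mul_of_nonneg_left (hh (v x) 0 (hv0 x)) (G.mu_pos x).le
    have e5 := mul_nonneg hl.le (mul_nonneg (G.kap_nonneg x) (hv0 x))
    rw [h0] at e4
    linarith
  have hT2 : ∀ u : X → ℝ, -v ≤ u → u ≤ v → -v ≤ T u := by
    intro u h1 h2 x
    refine hΨ2 x _ _ ?_
    have e1 := mul_le_mul_of_nonneg_left (hWm (-v) u hnegd (hdomd u h1 h2) h1 x) hl.le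
    have e2 := hvs x
    have e3 := mul_le_mul_of_nonneg_left (neg_abs_le (g x)) (G.mu_pos x).le
    have e4 := mul_le_mul_of_nonneg_left (hh 0 (-v x) (by linarith [hv0 x])) (G.mu_pos x).le
    have e5 := mul_nonneg hl.le (mul_nonneg (G.kap_nonneg x) (hv0 x))
    simp only [Pi.neg_apply, mul_neg, tsum_neg] at e1 ⊢
    rw [h0] at e4
    linarith
  haveI : Fact (-v ≤ v) := ⟨hvv⟩
  let F : Set.Icc (-v) v →o Set.Icc (-v) v :=
    ⟨fun u => ⟨T u.1, hT2 _ u.2.1 u.2.2, hT1 _ u.2.1 u.2.2⟩, by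
      intro u u' huu
      show T u.1 ≤ T u'.1
      intro x
      refine hΨm x ?_
      have := hWm u.1 u'.1 (hdomd _ u.2.1 u.2.2) (hdomd _ u'.2.1 u'.2.2) huu x
      have := mul_le_mul_of_nonneg_left this hl.le
      linarith⟩
  obtain ⟨u, hu1, hu2, hfix⟩ : ∃ u : X → ℝ, -v ≤ u ∧ u ≤ v ∧ T u = u :=
    ⟨F.lfp.1, F.lfp.2.1, F.lfp.2.2, congrArg Subtype.val F.map_lfp⟩
  have hud := hdomd u hu1 hu2
  have hab := hdom u hu1 hu2
  have hum := G.memLp_of_le hp hvm hab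
  refine ⟨u, hum, hud, fun x => ?_, le_trans ?_ hvn⟩
  · have e1 := hΨ x (G.mu x * g x + lam * ∑' y, G.w x y * u y)
    have e2 : Ψ x (G.mu x * g x + lam * ∑' y, G.w x y * u y) = u x := congrFun hfix x
    rw [e2] at e1
    have e3 := G.lap_eq hud x
    have e4 : G.mu x * (h (u x) + lam * G.lap u x) = G.mu x * g x := by
      rw [mul_add, show G.mu x * (lam * G.lap u x) = lam * (G.mu x * G.lap u x) by ring, e3]
      linarith
    exact mul_left_cancel₀ (G.mu_pos x).ne' e4
  · unfold lpNorm
    refine Real.rpow_le_rpow (tsum_nonneg fun x => ?_) ?_ (by positivity)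
    · have := (G.mu_pos x).le
      positivity
    · refine Summable.tsum_le_tsum (fun x => ?_) hum hvm
      have := (G.mu_pos x).le
      have := hab x
      gcongr

theorem aux_main (G : WGraph X) {p c lam : ℝ} (hp : 1 ≤ p) (hc : 0 < c) (hl : 0 < lam)
    (hcond : G.CondIP ∨ G.CondB) {f : ℝ → ℝ} (hcont : Continuous f)
    (hh : ∀ s t, t ≤ s → c * (s - t) ≤ (s - lam * f s) - (t - lam * f t)) (h0 : f 0 = 0)
    {g : X → ℝ} (hg : G.memLp p g) :
    (∃! u : X → ℝ, G.inDomA f p u ∧ ∀ x, u x + lam * G.Aop f u x = g x) ∧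
      (∀ u : X → ℝ, G.inDomA f p u → (∀ x, u x + lam * G.Aop f u x = g x) →
        G.lpNorm p u ≤ (2 : ℝ) ^ ((p - 1) / p) * c⁻¹ * G.lpNorm p g ∧
        ((∀ x, 0 ≤ g x) → ∀ x, 0 ≤ u x) ∧
        ((∀ x, g x ≤ 0) → ∀ x, u x ≤ 0)) := by
  have hcmp : ∀ {u v : X → ℝ}, G.memLp p u → G.memLp p v → G.inDomLap u → G.inDomLap v →
      (∀ x, u x + lam * G.Aop f u x ≤ v x + lam * G.Aop f v x) → ∀ x, u x ≤ v x := by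
    intro u v hu hv hud hvd hle
    refine G.aux_cmp hp hc hl hcond (fun s => s - lam * f s) hh hu hv hud hvd fun x => ?_
    have := hle x
    simp only [Aop] at this
    linarith
  obtain ⟨u, hum, hud, hue, hun⟩ := G.aux_exists hp hc hl (h := fun s => s - lam * f s)
    (by fun_prop) hh (by simp [h0]) hg
  have hue' : ∀ x, u x + lam * G.Aop f u x = g x := fun x => by
    rw [← hue x, Aop]; ring
  have huA : G.inDomA f p u := by
    refine ⟨hum, hud, ?_⟩
    have h1 := (G.memLp_sub hp hg hum).mul_left (lam⁻¹ ^ p)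
    refine h1.congr fun x => ?_
    have : G.Aop f u x = lam⁻¹ * (g x - u x) := by
      rw [← hue' x]; field_simp; ring
    rw [this, abs_mul, Real.mul_rpow (abs_nonneg _) (abs_nonneg _), abs_of_pos (inv_pos.2 hl),
      mul_assoc]
  have huniq : ∀ v : X → ℝ, G.inDomA f p v → (∀ x, v x + lam * G.Aop f v x = g x) → v = u := by
    intro v hv hve
    funext x
    refine le_antisymm ?_ ?_
    · exact hcmp hv.1 hum hv.2.1 hud (fun x => by rw [hve, hue']) x
    · exact hcmp hum hv.1 hud hv.2.1 (fun x => by rw [hve, hue']) x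
  refine ⟨⟨u, ⟨huA, hue'⟩, fun v hv => huniq v hv.1 hv.2⟩, fun v hv hve => ?_⟩
  have hp0 : 0 < p := by linarith
  have hz1 : G.memLp p (fun _ => 0) := by
    simp [memLp, Real.zero_rpow hp0.ne', summable_zero]
  have hz2 : G.inDomLap (fun _ => 0) := fun x => by simp [summable_zero]
  have hz3 : ∀ x, (0:ℝ) + lam * G.Aop f (fun _ => 0) x = 0 := fun x => by
    simp [Aop, lap, h0]
  refine ⟨?_, fun hg0 x => ?_, fun hg0 x => ?_⟩
  · rw [huniq v hv hve]
    refine hun.trans ?_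
    have h1 : (1:ℝ) ≤ 2 ^ ((p - 1) / p) :=
      Real.one_le_rpow (by norm_num) (div_nonneg (by linarith) hp0.le)
    have h2 : 0 ≤ c⁻¹ * G.lpNorm p g := by
      refine mul_nonneg (by positivity) (Real.rpow_nonneg (tsum_nonneg fun x => ?_) _)
      have := (G.mu_pos x).le
      positivity
    rw [mul_assoc]
    exact le_mul_of_one_le_left h2 h1
  · exact hcmp hz1 hv.1 hz2 hv.2.1 (fun x => by rw [hz3, hve]; exact hg0 x) x
  · exact hcmp hv.1 hz1 hv.2.1 hz2 (fun x => by rw [hz3, hve]; exact hg0 x) x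

end WGraph

/-- under (IP) or (B), for every `g ∈ ℓ^p(X,μ)` the equation
`u + λ𝒜u = g` has a unique solution in `dom_p(𝒜)`, with the estimate
`‖u‖_p ≤ 2^{(p-1)/p} C ‖g‖_p` and sign preservation. -/
theorem stmt11 {X : Type*} [Countable X] (G : WGraph X) (f : ℝ → ℝ) (p : ℝ)
    (hG : G.Connected) (hp : 1 ≤ p) (hCp : 1 < p → G.CondCp p)
    (hcond : G.CondIP ∨ G.CondB) :
    (CondF1 f → ∀ lam : ℝ, 0 < lam → ∀ g : X → ℝ, G.memLp p g →
      (∃! u : X → ℝ, G.inDomA f p u ∧ ∀ x, u x + lam * G.Aop f u x = g x) ∧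
      (∀ u : X → ℝ, G.inDomA f p u → (∀ x, u x + lam * G.Aop f u x = g x) →
        G.lpNorm p u ≤ (2 : ℝ) ^ ((p - 1) / p) * G.lpNorm p g ∧
        ((∀ x, 0 ≤ g x) → ∀ x, 0 ≤ u x) ∧
        ((∀ x, g x ≤ 0) → ∀ x, u x ≤ 0))) ∧
    (∀ L : ℝ, CondF2 f L → ∀ lam : ℝ, 0 < lam → lam < 1 / L →
      ∀ g : X → ℝ, G.memLp p g →
      (∃! u : X → ℝ, G.inDomA f p u ∧ ∀ x, u x + lam * G.Aop f u x = g x) ∧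
      (∀ u : X → ℝ, G.inDomA f p u → (∀ x, u x + lam * G.Aop f u x = g x) →
        G.lpNorm p u ≤ (2 : ℝ) ^ ((p - 1) / p) * (1 - lam * L)⁻¹ * G.lpNorm p g ∧
        ((∀ x, 0 ≤ g x) → ∀ x, 0 ≤ u x) ∧
        ((∀ x, g x ≤ 0) → ∀ x, u x ≤ 0))) := by
  refine ⟨fun hf lam hl g hg => ?_, fun L hf lam hl hlL g hg => ?_⟩
  · obtain ⟨h1, h2, h3⟩ := hf
    have := G.aux_main hp one_pos hl hcond h1 (fun s t hst => by
      have := mul_le_mul_of_nonneg_left (h2 hst) hl.le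
      linarith) h3 hg
    simpa only [inv_one, mul_one] using this
  · obtain ⟨hL, h2, h3⟩ := hf
    have hcl : lam * L < 1 := by rwa [lt_div_iff₀ hL] at hlL
    have hcont : Continuous f := by
      refine (LipschitzWith.of_dist_le_mul (K := ⟨L, hL.le⟩) fun s t => ?_).continuous
      rw [Real.dist_eq, Real.dist_eq]
      exact h2 t s
    refine G.aux_main hp (c := 1 - lam * L) (by linarith) hl hcond hcont (fun s t hst => ?_) h3 hg
    have h4 := h2 t s
    rw [abs_of_nonneg (by linarith : 0 ≤ s - t)] at h4
    have h5 := mul_le_mul_of_nonneg_left ((le_abs_self _).trans h4) hl.le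
    linarith
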